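/- Let R be an associative ring with unit. The following are equivalent: (a) findim(R) < ∞; (b) there exists a hereditary complete cotorsion pair (A, B) in Mod R with pd_A(A) < ∞ and resdim_A(P^{<∞}) < ∞; (c) every hereditary complete cotorsion pair (A, B) in Mod R with pd_A(A) < ∞ satisfies resdim_A(P^{<∞}) < ∞. -/

import Mathlib

noncomputable section

open CategoryTheory CategoryTheory.Limits Opposite DirectSum

universe u

namespace CotorsionDim

variable {R : Type u} [Ring R]

/-- `Ext^n_R(M,N) = 0`. -/
def ExtZero (M N : ModuleCat.{u} R) (n : ℕ) : Prop :=
  IsZero (((Ext ℤ (ModuleCat.{u} R) n).obj (op M)).obj N)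

/-- A pair of composable maps forms a short exact sequence `0 → A → B → C → 0`. -/
def IsSES {A B C : ModuleCat.{u} R} (f : A ⟶ B) (g : B ⟶ C) : Prop :=
  ∃ w : f ≫ g = 0, (CategoryTheory.ShortComplex.mk f g w).ShortExact

/-- relative projective dimension `pd_𝒳(M)` -/
def rpd (𝒳 : Set (ModuleCat.{u} R)) (M : ModuleCat.{u} R) : ℕ∞ :=
  sInf {n : ℕ∞ | ∀ j : ℕ, n < (j : ℕ∞) → ∀ X ∈ 𝒳, ExtZero M X j}

/-- relative injective dimension `id_𝒳(M)` -/
def rid (𝒳 : Set (ModuleCat.{u} R)) (M : ModuleCat.{u} R) : ℕ∞ :=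
  sInf {n : ℕ∞ | ∀ j : ℕ, n < (j : ℕ∞) → ∀ X ∈ 𝒳, ExtZero X M j}

/-- `pd_𝒳(𝒴)` -/
def rpdClass (𝒳 𝒴 : Set (ModuleCat.{u} R)) : ℕ∞ := ⨆ Y : 𝒴, rpd 𝒳 Y

/-- `id_𝒳(𝒴)` -/
def ridClass (𝒳 𝒴 : Set (ModuleCat.{u} R)) : ℕ∞ := ⨆ Y : 𝒴, rid 𝒳 Y

/-- projective dimension -/
def pd (M : ModuleCat.{u} R) : ℕ∞ := rpd Set.univ M

/-- injective dimension -/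
def idim (M : ModuleCat.{u} R) : ℕ∞ := rid Set.univ M

/-- `pd(𝒴)` -/
def pdClass (𝒴 : Set (ModuleCat.{u} R)) : ℕ∞ := ⨆ Y : 𝒴, pd Y.1

/-- `id(𝒴)` -/
def idClass (𝒴 : Set (ModuleCat.{u} R)) : ℕ∞ := ⨆ Y : 𝒴, idim Y.1

/-- `M` has an `𝒳`-resolution `0 → X_n → ⋯ → X_0 → M → 0` of length `n`. -/
def HasResLen (𝒳 : Set (ModuleCat.{u} R)) : ℕ → ModuleCat.{u} R → Prop
  | 0, M => M ∈ 𝒳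
  | n+1, M => ∃ (K X : ModuleCat.{u} R) (f : K ⟶ X) (g : X ⟶ M),
      X ∈ 𝒳 ∧ IsSES f g ∧ HasResLen 𝒳 n K

/-- `M` has an `𝒳`-coresolution `0 → M → X_0 → ⋯ → X_n → 0` of length `n`. -/
def HasCoresLen (𝒳 : Set (ModuleCat.{u} R)) : ℕ → ModuleCat.{u} R → Prop
  | 0, M => M ∈ 𝒳
  | n+1, M => ∃ (X C : ModuleCat.{u} R) (f : M ⟶ X) (g : X ⟶ C),
      X ∈ 𝒳 ∧ IsSES f g ∧ HasCoresLen 𝒳 n C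

/-- `resdim_𝒳(M)` -/
def resdim (𝒳 : Set (ModuleCat.{u} R)) (M : ModuleCat.{u} R) : ℕ∞ :=
  ⨅ n : {n : ℕ // HasResLen 𝒳 n M}, (n : ℕ∞)

/-- `coresdim_𝒳(M)` -/
def coresdim (𝒳 : Set (ModuleCat.{u} R)) (M : ModuleCat.{u} R) : ℕ∞ :=
  ⨅ n : {n : ℕ // HasCoresLen 𝒳 n M}, (n : ℕ∞)

/-- `resdim_𝒳(𝒴)` -/
def resdimClass (𝒳 𝒴 : Set (ModuleCat.{u} R)) : ℕ∞ := ⨆ Y : 𝒴, resdim 𝒳 Y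

/-- `coresdim_𝒳(𝒴)` -/
def coresdimClass (𝒳 𝒴 : Set (ModuleCat.{u} R)) : ℕ∞ := ⨆ Y : 𝒴, coresdim 𝒳 Y

/-- `𝒳^∧`, the class of modules with a finite `𝒳`-resolution. -/
def resClosure (𝒳 : Set (ModuleCat.{u} R)) : Set (ModuleCat.{u} R) :=
  {M | ∃ n, HasResLen 𝒳 n M}

/-- `𝒳^∨`, the class of modules with a finite `𝒳`-coresolution. -/
def coresClosure (𝒳 : Set (ModuleCat.{u} R)) : Set (ModuleCat.{u} R) :=
  {M | ∃ n, HasCoresLen 𝒳 n M}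

/-- `(𝒜, ℬ)` is a cotorsion pair. -/
def IsCotorsionPair (𝒜 ℬ : Set (ModuleCat.{u} R)) : Prop :=
  (∀ M, M ∈ 𝒜 ↔ ∀ B ∈ ℬ, ExtZero M B 1) ∧
  (∀ M, M ∈ ℬ ↔ ∀ A ∈ 𝒜, ExtZero A M 1)

/-- completeness of a cotorsion pair -/
def IsComplete (𝒜 ℬ : Set (ModuleCat.{u} R)) : Prop :=
  ∀ M : ModuleCat.{u} R,
    (∃ (B A : ModuleCat.{u} R) (f : B ⟶ A) (g : A ⟶ M), B ∈ ℬ ∧ A ∈ 𝒜 ∧ IsSES f g) ∧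
    (∃ (B A : ModuleCat.{u} R) (f : M ⟶ B) (g : B ⟶ A), B ∈ ℬ ∧ A ∈ 𝒜 ∧ IsSES f g)

/-- heredity of a cotorsion pair -/
def IsHereditary (𝒜 ℬ : Set (ModuleCat.{u} R)) : Prop :=
  ∀ i : ℕ, 1 ≤ i → ∀ A ∈ 𝒜, ∀ B ∈ ℬ, ExtZero A B i

variable (R)

/-- `𝒫`, the class of modules of finite projective dimension. -/
def P : Set (ModuleCat.{u} R) := {M | pd M < ⊤}

variable {R}

/-- `M` admits a projective resolution consisting of finitely generated projectives,
i.e. `M ∈ mod R`. -/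
def InmodR (M : ModuleCat.{u} R) : Prop :=
  ∃ K : ℕ → ModuleCat.{u} R, K 0 = M ∧ ∀ i : ℕ,
    ∃ (Q : ModuleCat.{u} R) (f : K (i+1) ⟶ Q) (g : Q ⟶ K i),
      Module.Finite R Q ∧ Projective Q ∧ IsSES f g

variable (R)

/-- `𝒫^{<∞} = 𝒫 ∩ mod R`. -/
def Pfin : Set (ModuleCat.{u} R) := {M | pd M < ⊤ ∧ InmodR M}

/-- the big finitistic dimension -/
def bigFindim : ℕ∞ := pdClass (P R)

/-- the little finitistic dimension -/
def littleFindim : ℕ∞ := pdClass (Pfin R)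

variable {R}

/-- `𝒳^{⊥₁}` -/
def rperp1 (𝒳 : Set (ModuleCat.{u} R)) : Set (ModuleCat.{u} R) :=
  {M | ∀ X ∈ 𝒳, ExtZero X M 1}

/-- `^{⊥₁}𝒳` -/
def lperp1 (𝒳 : Set (ModuleCat.{u} R)) : Set (ModuleCat.{u} R) :=
  {M | ∀ X ∈ 𝒳, ExtZero M X 1}

/-- `T^⊥ = {M : Ext^i(T,M) = 0 for all i > 0}` -/
def rperpAll (T : ModuleCat.{u} R) : Set (ModuleCat.{u} R) :=
  {M | ∀ i : ℕ, 0 < i → ExtZero T M i}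

/-- `Add T`: direct summands of arbitrary direct sums of copies of `T`. -/
def AddT (T : ModuleCat.{u} R) : Set (ModuleCat.{u} R) :=
  {M | ∃ (I : Type u) (s : M ⟶ ModuleCat.of R (I →₀ T)) (r : ModuleCat.of R (I →₀ T) ⟶ M),
    s ≫ r = 𝟙 M}

/-- `T` is a tilting module. -/
def IsTilting (T : ModuleCat.{u} R) : Prop :=
  pd T < ⊤ ∧
  (∀ i : ℕ, 0 < i → ∀ I : Type u, ExtZero T (ModuleCat.of R (I →₀ T)) i) ∧
  ∃ n, HasCoresLen (AddT T) n (ModuleCat.of R R)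


/-- `𝒳` is closed under arbitrary direct sums (coproducts). -/
def ClosedUnderCoproducts (𝒳 : Set (ModuleCat.{u} R)) : Prop :=
  ∀ (I : Type u) (f : I → ModuleCat.{u} R), (∀ i, f i ∈ 𝒳) →
    ModuleCat.of R (⨁ i, (f i : Type u)) ∈ 𝒳

/-- `𝒳` is closed under direct summands. -/
def ClosedUnderSummands (𝒳 : Set (ModuleCat.{u} R)) : Prop :=
  ∀ (M N : ModuleCat.{u} R) (s : M ⟶ N) (r : N ⟶ M), s ≫ r = 𝟙 M → N ∈ 𝒳 → M ∈ 𝒳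

/-- Vanishing of the derived-functor `Ext` in positive degree agrees with vanishing of `Abelian.Ext`. -/
lemma extZero_succ_iff [HasExt.{u} (ModuleCat.{u} R)] (M N : ModuleCat.{u} R) (p : ℕ) :
    ExtZero M N (p + 1) ↔ ∀ e : Abelian.Ext.{u} M N (p + 1), e = 0 := by
  let Q := projectiveResolution M
  have h₁ : ExtZero M N (p + 1) ↔ ∀ f : Q.complex.X (p + 1) ⟶ N,
      Q.complex.d (p + 2) (p + 1) ≫ f = 0 →
        ∃ g : Q.complex.X p ⟶ N, Q.complex.d (p + 1) p ≫ g = f := by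
    rw [ExtZero, (Q.isoExt (R := ℤ) (p + 1) N).isZero_iff,
      ← HomologicalComplex.exactAt_iff_isZero_homology,
      HomologicalComplex.exactAt_iff' _ p (p + 1) (p + 2) (by simp) (by simp),
      ShortComplex.moduleCat_exact_iff]
    rfl
  rw [h₁]
  constructor
  · intro h e
    obtain ⟨f, hf, rfl⟩ := Q.extMk_surjective e (p + 2) rfl
    exact (Q.extMk_eq_zero_iff f (p + 2) rfl hf p rfl).2 (h f hf)
  · intro h f hf
    exact (Q.extMk_eq_zero_iff f (p + 2) rfl hf p rfl).1 (h _)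

lemma extZero_iff [HasExt.{u} (ModuleCat.{u} R)] (M N : ModuleCat.{u} R) {j : ℕ} (hj : 0 < j) :
    ExtZero M N j ↔ ∀ e : Abelian.Ext.{u} M N j, e = 0 := by
  obtain ⟨p, rfl⟩ := Nat.exists_eq_succ_of_ne_zero hj.ne'
  exact extZero_succ_iff M N p

lemma extZero_of_projective (M N : ModuleCat.{u} R) [Projective M] {j : ℕ} (hj : 0 < j) :
    ExtZero M N j :=
  (extZero_iff M N hj).2 fun e ↦ e.eq_zero_of_hasProjectiveDimensionLT 1 hj

lemma projective_iff_extZero_one (M : ModuleCat.{u} R) :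
    Projective M ↔ ∀ N, ExtZero M N 1 := by
  refine ⟨fun _ N ↦ extZero_of_projective M N one_pos, fun h ↦ ?_⟩
  rw [projective_iff_subsingleton_ext_one.{u}]
  intro N
  have := (extZero_iff M N one_pos).1 (h N)
  exact ⟨fun a b ↦ by rw [this a, this b]⟩

lemma rpd_le_coe_iff (𝒳 : Set (ModuleCat.{u} R)) (M : ModuleCat.{u} R) (n : ℕ) :
    rpd 𝒳 M ≤ n ↔ ∀ j : ℕ, n < j → ∀ X ∈ 𝒳, ExtZero M X j := by
  constructor
  · intro h j hj X hX
    obtain ⟨k, hk, hkj⟩ := sInf_lt_iff.1 (h.trans_lt (Nat.cast_lt.2 hj))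
    exact hk j hkj X hX
  · intro h
    exact sInf_le fun j hj ↦ h j (Nat.cast_lt.1 hj)

lemma pd_le_coe_iff (M : ModuleCat.{u} R) (n : ℕ) :
    pd M ≤ n ↔ HasProjectiveDimensionLE M n := by
  rw [pd, rpd_le_coe_iff, HasProjectiveDimensionLE, hasProjectiveDimensionLT_iff.{u}]
  constructor
  · intro h i hi Y
    exact (extZero_iff M Y (by lia)).1 (h i (by lia) Y trivial)
  · intro h j hj X _
    exact (extZero_iff M X (by lia)).2 fun e ↦ h j (by lia) e

lemma hasResLen_of_pd_le {𝒳 : Set (ModuleCat.{u} R)} (h𝒳 : ∀ Q, Projective Q → Q ∈ 𝒳) (n : ℕ)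
    (M : ModuleCat.{u} R) (hM : pd M ≤ n) : HasResLen 𝒳 n M := by
  rw [pd_le_coe_iff] at hM
  induction n generalizing M with
  | zero => exact h𝒳 M ((projective_iff_hasProjectiveDimensionLE_zero M).2 hM)
  | succ n ih =>
    have hS : (ShortComplex.mk (kernel.ι (Projective.π M)) (Projective.π M)
        (kernel.condition _)).ShortExact :=
      { exact := ShortComplex.exact_kernel _ }
    exact ⟨_, _, _, _, h𝒳 _ inferInstance, ⟨_, hS⟩, ih _
      ((hS.hasProjectiveDimensionLT_X₃_iff n (inferInstanceAs (Projective (Projective.over M)))).1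
        hM)⟩

lemma resdim_le_pd {𝒳 : Set (ModuleCat.{u} R)} (h𝒳 : ∀ Q, Projective Q → Q ∈ 𝒳)
    (M : ModuleCat.{u} R) : resdim 𝒳 M ≤ pd M := by
  generalize h : pd M = d
  induction d using ENat.recTopCoe with
  | top => exact le_top
  | coe n => exact iInf_le_of_le ⟨n, hasResLen_of_pd_le h𝒳 n M h.le⟩ le_rfl

lemma rpd_le_of_hasResLen {𝒳 𝒴 : Set (ModuleCat.{u} R)} {m : ℕ} (h : ∀ X ∈ 𝒳, rpd 𝒴 X ≤ m)
    (n : ℕ) (M : ModuleCat.{u} R) (hM : HasResLen 𝒳 n M) : rpd 𝒴 M ≤ (m + n : ℕ) := by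
  induction n generalizing M with
  | zero => exact h M hM
  | succ n ih =>
    obtain ⟨K, X, f, g, hX, ⟨w, hS⟩, hK⟩ := hM
    rw [rpd_le_coe_iff]
    intro j hj Y hY
    obtain ⟨j, rfl⟩ := Nat.exists_eq_succ_of_ne_zero (show j ≠ 0 by lia)
    rw [extZero_iff _ _ (by lia)]
    intro e
    obtain ⟨x, rfl⟩ := Abelian.Ext.contravariant_sequence_exact₃ hS Y e
      ((extZero_iff X Y (by lia)).1
        ((rpd_le_coe_iff _ _ _).1 (h X hX) _ (by lia) Y hY) _) (add_comm 1 j)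
    rw [(extZero_iff K Y (by lia)).1
      ((rpd_le_coe_iff _ _ _).1 (ih K hK) j (by lia) Y hY) x, Abelian.Ext.comp_zero]

/-- A module of finite projective dimension has projective dimension `≤ n` as soon as its
projective dimension relative to a class containing the projectives is `≤ n`. -/
lemma pd_le_of_rpd_le {𝒳 : Set (ModuleCat.{u} R)} (h𝒳 : ∀ Q, Projective Q → Q ∈ 𝒳)
    {M : ModuleCat.{u} R} {n : ℕ} (h : rpd 𝒳 M ≤ n) (hM : pd M < ⊤) : pd M ≤ n := by
  obtain ⟨d, hd⟩ := ENat.ne_top_iff_exists.1 hM.ne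
  replace hd := hd.symm.le
  induction d with
  | zero => exact hd.trans (by simp)
  | succ d ih =>
    by_cases hdn : d + 1 ≤ n
    · exact hd.trans (by exact_mod_cast hdn)
    refine ih ?_
    rw [pd, rpd_le_coe_iff] at hd ⊢
    intro j hj N _
    rcases (Nat.succ_le_of_lt hj).lt_or_eq with hj' | rfl
    · exact hd j hj' N trivial
    rw [extZero_iff _ _ (by lia)]
    intro e
    have hS : (ShortComplex.mk (kernel.ι (Projective.π N)) (Projective.π N)
        (kernel.condition _)).ShortExact :=
      { exact := ShortComplex.exact_kernel _ }
    obtain ⟨x, rfl⟩ := Abelian.Ext.covariant_sequence_exact₃ M hS e rfl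
      ((extZero_iff _ _ (by lia)).1 (hd (d + 1 + 1) (by lia) _ trivial) _)
    rw [(extZero_iff _ _ (by lia)).1 ((rpd_le_coe_iff _ _ _).1 h (d + 1) (by lia) _
      (h𝒳 _ inferInstance)) x, Abelian.Ext.zero_comp]

lemma IsCotorsionPair.mem_of_projective {𝒜 ℬ : Set (ModuleCat.{u} R)} (h : IsCotorsionPair 𝒜 ℬ)
    (Q : ModuleCat.{u} R) (hQ : Projective Q) : Q ∈ 𝒜 :=
  (h.1 Q).2 fun B _ ↦ extZero_of_projective Q B one_pos

lemma isCotorsionPair_projective :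
    IsCotorsionPair {M : ModuleCat.{u} R | Projective M} Set.univ :=
  ⟨fun M ↦ by simpa using projective_iff_extZero_one M,
    fun M ↦ ⟨fun _ A (hA : Projective A) ↦ extZero_of_projective A M one_pos, fun _ ↦ trivial⟩⟩

lemma isComplete_projective :
    IsComplete {M : ModuleCat.{u} R | Projective M} Set.univ := fun M ↦
  ⟨⟨_, Projective.over M, kernel.ι (Projective.π M), Projective.π M, trivial,
      inferInstanceAs (Projective (Projective.over M)), kernel.condition _,
      { exact := ShortComplex.exact_kernel _ }⟩,
    ⟨M, ModuleCat.of R PUnit, 𝟙 M, 0, trivial,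
      (ModuleCat.isZero_of_subsingleton _).projective, by simp,
      (ShortComplex.Splitting.ofIsIsoOfIsZero _
        (inferInstance : IsIso (𝟙 M)) (ModuleCat.isZero_of_subsingleton _)).shortExact⟩⟩

lemma isHereditary_projective :
    IsHereditary {M : ModuleCat.{u} R | Projective M} Set.univ :=
  fun _ hi A (_ : Projective A) B _ ↦ extZero_of_projective A B hi

lemma rpdClass_projective_lt_top :
    rpdClass {M : ModuleCat.{u} R | Projective M} {M | Projective M} < ⊤ := by
  refine lt_of_le_of_lt (iSup_le fun M ↦ ?_) (ENat.natCast_lt_top 0)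
  have : Projective M.1 := M.2
  rw [rpd_le_coe_iff]
  exact fun j hj X _ ↦ extZero_of_projective M.1 X hj

lemma resdimClass_Pfin_le {𝒳 : Set (ModuleCat.{u} R)} (h𝒳 : ∀ Q, Projective Q → Q ∈ 𝒳) :
    resdimClass 𝒳 (Pfin R) ≤ littleFindim R :=
  iSup_mono fun M ↦ resdim_le_pd h𝒳 M.1

lemma littleFindim_lt_top {𝒳 : Set (ModuleCat.{u} R)} (h𝒳 : ∀ Q, Projective Q → Q ∈ 𝒳)
    (h : rpdClass 𝒳 𝒳 < ⊤) (h' : resdimClass 𝒳 (Pfin R) < ⊤) : littleFindim R < ⊤ := by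
  obtain ⟨m, hm⟩ := ENat.ne_top_iff_exists.1 h.ne
  obtain ⟨n, hn⟩ := ENat.ne_top_iff_exists.1 h'.ne
  refine lt_of_le_of_lt (iSup_le fun M ↦ ?_) (ENat.natCast_lt_top (m + n))
  have hM : resdim 𝒳 M.1 ≤ n := (le_iSup (fun Y : Pfin R ↦ resdim 𝒳 Y.1) M).trans hn.ge
  obtain ⟨⟨k, hk⟩, hkn⟩ := iInf_lt_iff.1 (hM.trans_lt (Nat.cast_lt.2 (Nat.lt_succ_self n)))
  have hX : ∀ X ∈ 𝒳, rpd 𝒳 X ≤ m := fun X hX ↦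
    (le_iSup (fun Y : 𝒳 ↦ rpd 𝒳 Y.1) ⟨X, hX⟩).trans hm.ge
  refine pd_le_of_rpd_le h𝒳 ((rpd_le_of_hasResLen hX k M.1 hk).trans ?_) M.2.1
  have : k < n + 1 := Nat.cast_lt.1 hkn
  exact_mod_cast (by lia : m + k ≤ m + n)

/-- Corollary 4.3(II): criteria for finiteness of the little finitistic dimension. -/
theorem stmt3 {R : Type u} [Ring R] :
    (littleFindim R < ⊤ ↔
      ∃ 𝒜 ℬ : Set (ModuleCat.{u} R), IsCotorsionPair 𝒜 ℬ ∧ IsComplete 𝒜 ℬ ∧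
        IsHereditary 𝒜 ℬ ∧ rpdClass 𝒜 𝒜 < ⊤ ∧ resdimClass 𝒜 (Pfin R) < ⊤) ∧
    (littleFindim R < ⊤ ↔
      ∀ 𝒜 ℬ : Set (ModuleCat.{u} R), IsCotorsionPair 𝒜 ℬ → IsComplete 𝒜 ℬ →
        IsHereditary 𝒜 ℬ → rpdClass 𝒜 𝒜 < ⊤ → resdimClass 𝒜 (Pfin R) < ⊤) := by
  refine ⟨⟨fun h ↦ ⟨_, _, isCotorsionPair_projective, isComplete_projective,
      isHereditary_projective, rpdClass_projective_lt_top,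
      (resdimClass_Pfin_le fun _ hQ ↦ hQ).trans_lt h⟩, ?_⟩, fun h 𝒜 ℬ hc _ _ _ ↦
      (resdimClass_Pfin_le hc.mem_of_projective).trans_lt h, fun h ↦ ?_⟩
  · rintro ⟨𝒜, ℬ, hc, -, -, h, h'⟩
    exact littleFindim_lt_top hc.mem_of_projective h h'
  · exact littleFindim_lt_top (fun _ hQ ↦ hQ) rpdClass_projective_lt_top
      (h _ _ isCotorsionPair_projective isComplete_projective isHereditary_projective
        rpdClass_projective_lt_top)

end CotorsionDim
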